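/- Let (D, ω) be a positive weighted loopless symmetric digraph. The characteristic polynomial of A(D, ω′) is the same for every skew-signing ω′ of (D, ω) if and only if D has no directed cycle of even length greater than 2 and A(D, ω) = Δ⁻¹·S·Δ for some nonnegative symmetric matrix S with zero diagonal and some diagonal matrix Δ with positive diagonal entries. -/

import Mathlib

open Matrix

/-- `B` is the weighted adjacency matrix of a skew-signing of the positive weighted
loopless symmetric digraph with weighted adjacency matrix `A`. -/
def IsSkewSigning {n : ℕ} (A B : Matrix (Fin n) (Fin n) ℝ) : Prop :=
  (∀ i j, |B i j| = A i j) ∧ (∀ i j, A i j ≠ 0 → B i j * B j i < 0)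

section Helpers

open Equiv Equiv.Perm

/-- reverse the cycle of `σ` through `x` -/
def revCyc {n : ℕ} (σ : Perm (Fin n)) (x : Fin n) : Perm (Fin n) :=
  σ * ((σ.cycleOf x)⁻¹ * (σ.cycleOf x)⁻¹)

lemma cycleOf_inv_apply_same {n : ℕ} (σ : Perm (Fin n)) (x y : Fin n) (h : σ.SameCycle x y) :
    (σ.cycleOf x)⁻¹ y = σ⁻¹ y := by
  rw [cycleOf_inv, SameCycle.cycleOf_apply (sameCycle_inv.2 h)]

lemma cycleOf_inv_apply_nsame {n : ℕ} (σ : Perm (Fin n)) (x y : Fin n) (h : ¬ σ.SameCycle x y) :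
    (σ.cycleOf x)⁻¹ y = y := by
  rw [cycleOf_inv, cycleOf_apply_of_not_sameCycle (fun h' => h (sameCycle_inv.1 h'))]

lemma sameCycle_inv_apply_right' {n : ℕ} (σ : Perm (Fin n)) (x y : Fin n) :
    σ.SameCycle x (σ⁻¹ y) ↔ σ.SameCycle x y := by
  rw [← sameCycle_apply_right]
  simp

lemma revCyc_same {n : ℕ} (σ : Perm (Fin n)) (x y : Fin n) (h : σ.SameCycle x y) :
    revCyc σ x y = σ⁻¹ y := by
  have h2 : σ.SameCycle x (σ⁻¹ y) := (sameCycle_inv_apply_right' σ x y).2 h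
  simp only [revCyc, Perm.mul_apply]
  rw [cycleOf_inv_apply_same σ x y h, cycleOf_inv_apply_same σ x _ h2]
  simp

lemma revCyc_nsame {n : ℕ} (σ : Perm (Fin n)) (x y : Fin n) (h : ¬ σ.SameCycle x y) :
    revCyc σ x y = σ y := by
  simp only [revCyc, Perm.mul_apply]
  rw [cycleOf_inv_apply_nsame σ x y h, cycleOf_inv_apply_nsame σ x _ h]

lemma commute_cycleOf {n : ℕ} (σ : Perm (Fin n)) (x : Fin n) : Commute σ (σ.cycleOf x) := by
  ext y
  simp only [Perm.mul_apply]
  by_cases h : σ.SameCycle x y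
  · rw [h.cycleOf_apply, SameCycle.cycleOf_apply (sameCycle_apply_right.2 h)]
  · rw [cycleOf_apply_of_not_sameCycle h,
      cycleOf_apply_of_not_sameCycle (fun h' => h (sameCycle_apply_right.1 h'))]

lemma revCyc_cycleOf {n : ℕ} (σ : Perm (Fin n)) (x : Fin n) (hx : σ x ≠ x) :
    (revCyc σ x).cycleOf x = (σ.cycleOf x)⁻¹ := by
  have hc := commute_cycleOf σ x
  have h1 : revCyc σ x = (σ.cycleOf x)⁻¹ * (σ * (σ.cycleOf x)⁻¹) := by
    unfold revCyc
    rw [← mul_assoc, ← mul_assoc, (hc.inv_right).eq]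
  rw [h1, cycleOf_mul_of_apply_right_eq_self]
  · rw [← cycleOf_inv, (isCycle_cycleOf σ hx).cycleOf, if_neg]
    rwa [cycleOf_apply_self]
  · exact (hc.inv_right.mul_left (Commute.refl _)).symm
  · rw [Perm.mul_apply, cycleOf_inv_apply_same σ x x (SameCycle.refl _ _)]
    simp

lemma revCyc_revCyc {n : ℕ} (σ : Perm (Fin n)) (x : Fin n) (hx : σ x ≠ x) :
    revCyc (revCyc σ x) x = σ := by
  rw [revCyc, revCyc_cycleOf σ x hx, revCyc]
  simp [mul_assoc]

lemma revCyc_sign {n : ℕ} (σ : Perm (Fin n)) (x : Fin n) :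
    sign (revCyc σ x) = sign σ := by
  simp [revCyc, Perm.sign_mul]

def badSet {n : ℕ} (σ : Perm (Fin n)) : Finset (Fin n) :=
  Finset.univ.filter (fun x => σ (σ x) ≠ x)

lemma badSet_revCyc {n : ℕ} (σ : Perm (Fin n)) (x : Fin n) :
    badSet (revCyc σ x) = badSet σ := by
  ext y
  simp only [badSet, Finset.mem_filter, Finset.mem_univ, true_and]
  apply not_congr
  by_cases h : σ.SameCycle x y
  · rw [revCyc_same σ x y h, revCyc_same σ x _ ((sameCycle_inv_apply_right' σ x y).2 h)]
    rw [Perm.inv_eq_iff_eq, Perm.inv_eq_iff_eq, eq_comm]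
  · rw [revCyc_nsame σ x y h, revCyc_nsame σ x _ (fun h' => h (sameCycle_apply_right.1 h'))]

lemma skew_cycle_sum {R : Type*} [CommRing R] {n : ℕ} (N : Matrix (Fin n) (Fin n) R)
    (hs : ∀ i j, i ≠ j → N j i = - N i j)
    (hev : ∀ (σ : Perm (Fin n)) (x : Fin n), σ (σ x) ≠ x → Even (σ.cycleOf x).support.card →
      ∏ i ∈ (σ.cycleOf x).support, N (σ i) i = 0) :
    ∑ σ ∈ Finset.univ.filter (fun σ : Perm (Fin n) => (badSet σ).Nonempty),
      sign σ • ∏ i, N (σ i) i = 0 := by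
  have key : ∀ (σ : Perm (Fin n)) (x : Fin n), σ (σ x) ≠ x →
      (sign σ • ∏ i, N (σ i) i) +
      (sign (revCyc σ x) • ∏ i, N (revCyc σ x i) i) = 0 := by
    intro σ x hx
    have hx1 : σ x ≠ x := fun h => hx (by rw [h, h])
    rw [revCyc_sign, ← smul_add]
    set s := (σ.cycleOf x).support with hsdef
    have hmem : ∀ y, y ∈ s ↔ σ.SameCycle x y := by
      intro y
      rw [hsdef, mem_support_cycleOf_iff]
      simp [hx1]
    rw [← Finset.prod_mul_prod_compl s (fun i => N (σ i) i),
      ← Finset.prod_mul_prod_compl s (fun i => N (revCyc σ x i) i)]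
    have h1 : ∏ i ∈ sᶜ, N (revCyc σ x i) i = ∏ i ∈ sᶜ, N (σ i) i := by
      refine Finset.prod_congr rfl fun i hi => ?_
      rw [Finset.mem_compl, hmem] at hi
      rw [revCyc_nsame σ x i hi]
    have h2 : ∏ i ∈ s, N (revCyc σ x i) i = ∏ i ∈ s, N i (σ i) := by
      symm
      refine Finset.prod_equiv σ (fun i => ?_) (fun i hi => ?_)
      · rw [hmem, hmem, sameCycle_apply_right]
      · rw [hmem] at hi
        rw [revCyc_same σ x _ (sameCycle_apply_right.2 hi)]
        simp
    have h3 : ∏ i ∈ s, N i (σ i) = (-1) ^ s.card * ∏ i ∈ s, N (σ i) i := by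
      rw [← Finset.prod_const, ← Finset.prod_mul_distrib]
      refine Finset.prod_congr rfl fun i hi => ?_
      rw [hmem] at hi
      have : σ i ≠ i := by
        intro h
        exact hx1 ((hi.apply_eq_self_iff).2 h)
      rw [hs _ _ this]; ring
    rw [h1, h2, h3]
    rcases Nat.even_or_odd s.card with he | ho
    · rw [hev σ x hx he]; simp
    · rw [ho.neg_one_pow]; simp
  have hb : ∀ (σ : Perm (Fin n)) (h : (badSet σ).Nonempty),
      σ (σ ((badSet σ).min' h)) ≠ (badSet σ).min' h := by
    intro σ h
    have := Finset.min'_mem _ h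
    exact (Finset.mem_filter.1 this).2
  refine Finset.sum_involution
    (fun σ h => revCyc σ ((badSet σ).min' (Finset.mem_filter.1 h).2)) ?_ ?_ ?_ ?_
  · intro σ h
    exact key σ _ (hb _ _)
  · intro σ h _ heq
    have h0 := hb σ (Finset.mem_filter.1 h).2
    set x := (badSet σ).min' (Finset.mem_filter.1 h).2
    have : revCyc σ x x = σ x := by rw [heq]
    rw [revCyc_same σ x x (SameCycle.refl _ _)] at this
    rw [← this] at h0
    simp at h0
  · intro σ h
    simp only [Finset.mem_filter, Finset.mem_univ, true_and, badSet_revCyc]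
    exact (Finset.mem_filter.1 h).2
  · intro σ h
    simp only [badSet_revCyc]
    apply revCyc_revCyc
    intro h'
    exact hb σ (Finset.mem_filter.1 h).2 (by rw [h', h'])

lemma finRotate_val {k : ℕ} (j : Fin k) : ((finRotate k j : Fin k) : ℕ) = (j + 1) % k := by
  obtain ⟨m, rfl⟩ : ∃ m, k = m + 1 := ⟨k - 1, by have := j.2; omega⟩
  rw [finRotate_apply, Fin.val_add]
  simp

lemma charpoly_eq_of_skew {n : ℕ} (T₁ T₂ : Matrix (Fin n) (Fin n) ℝ)
    (h1 : ∀ i j, T₁ j i = - T₁ i j) (h2 : ∀ i j, T₂ j i = - T₂ i j)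
    (habs : ∀ i j, |T₁ i j| = |T₂ i j|)
    (hev : ∀ k : ℕ, 2 < k → Even k → ∀ v : Fin k → Fin n, Function.Injective v →
          ∃ j : Fin k, T₁ (v j) (v (finRotate k j)) = 0) :
    T₁.charpoly = T₂.charpoly := by
  have hred : ∀ T : Matrix (Fin n) (Fin n) ℝ, (∀ i j, T j i = - T i j) →
      (∀ i j, T₁ i j = 0 → T i j = 0) →
      T.charpoly = ∑ σ ∈ Finset.univ.filter (fun σ : Perm (Fin n) => ¬ (badSet σ).Nonempty),
        sign σ • ∏ i, T.charmatrix (σ i) i := by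
    intro T hT hz
    rw [Matrix.charpoly, Matrix.det_apply,
      ← Finset.sum_filter_add_sum_filter_not _ (fun σ : Perm (Fin n) => (badSet σ).Nonempty),
      skew_cycle_sum, zero_add]
    · intro i j hij
      rw [Matrix.charmatrix_apply_ne _ _ _ hij, Matrix.charmatrix_apply_ne _ _ _ hij.symm, hT i j]
      simp
    · intro σ x hx he
      have hx1 : σ x ≠ x := fun h => hx (by rw [h, h])
      have hcyc := isCycle_cycleOf σ hx1
      have hord := hcyc.orderOf
      set k := (σ.cycleOf x).support.card with hk
      have hpow : ∀ m : ℕ, (σ ^ (m % k)) x = (σ ^ m) x := by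
        intro m
        rw [← cycleOf_pow_apply_self σ x (m % k), ← cycleOf_pow_apply_self σ x m, ← hord, pow_mod_orderOf]
      have hk2 : 2 < k := by
        have := hcyc.two_le_card_support
        rcases this.lt_or_eq with h | h
        · exact h
        · exfalso
          have := hpow 2
          rw [← hk] at h
          rw [← h] at this
          simp [pow_two] at this
          exact hx this.symm
      obtain ⟨j, hj⟩ := hev k hk2 he (fun j => (σ ^ (j : ℕ)) x) (by
        intro a b hab
        simp only at hab
        rw [← cycleOf_pow_apply_self σ x a, ← cycleOf_pow_apply_self σ x b] at hab
        have := (hcyc.pow_eq_pow_iff).2 ⟨x, by rwa [cycleOf_apply_self], hab⟩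
        have h3 := pow_injOn_Iio_orderOf (x := σ.cycleOf x) (by rw [hord]; exact a.2)
          (by rw [hord]; exact b.2) this
        exact Fin.ext h3)
      have hrot : (σ ^ ((finRotate k j : Fin k) : ℕ)) x = σ ((σ ^ (j : ℕ)) x) := by
        rw [finRotate_val, hpow, pow_succ', Perm.mul_apply]
      rw [hrot] at hj
      refine Finset.prod_eq_zero (i := (σ ^ (j : ℕ)) x) ?_ ?_
      · rw [mem_support_cycleOf_iff]
        exact ⟨⟨j, by simp⟩, by simpa using hx1⟩
      · have hne : σ ((σ ^ (j : ℕ)) x) ≠ (σ ^ (j : ℕ)) x := by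
          intro h
          rw [← Perm.mul_apply, ← pow_succ', pow_succ, Perm.mul_apply] at h
          exact hx1 ((σ ^ (j:ℕ)).injective h)
        rw [Matrix.charmatrix_apply_ne _ _ _ hne, hT, hz _ _ hj]
        simp
  rw [hred T₁ h1 (fun _ _ h => h), hred T₂ h2 (fun i j h => by
    have := habs i j
    rw [h] at this
    simpa using this.symm)]
  refine Finset.sum_congr rfl fun σ hσ => ?_
  have hinv : ∀ i, σ (σ i) = i := by
    intro i
    by_contra h
    exact (Finset.mem_filter.1 hσ).2 ⟨i, Finset.mem_filter.2 ⟨Finset.mem_univ _, h⟩⟩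
  congr 1
  classical
  let ε : Fin n → Fin n → Polynomial ℝ := fun i j => if T₁ i j = T₂ i j then 1 else -1
  have hT0 : ∀ T : Matrix (Fin n) (Fin n) ℝ, (∀ i j, T j i = - T i j) → ∀ i, T i i = 0 := by
    intro T hT i
    have := hT i i
    linarith
  have hε : ∀ i j, T₁.charmatrix i j = ε i j * T₂.charmatrix i j := by
    intro i j
    by_cases hij : i = j
    · subst hij
      simp [ε, hT0 T₁ h1, hT0 T₂ h2]
    · rw [Matrix.charmatrix_apply_ne _ _ _ hij, Matrix.charmatrix_apply_ne _ _ _ hij]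
      rcases abs_eq_abs.1 (habs i j) with h | h
      · simp [ε, h]
      · by_cases h' : T₁ i j = T₂ i j
        · simp [ε, h']
        · simp only [ε, if_neg h', h]; simp
  have hprod : ∏ i, ε (σ i) i = 1 := by
    refine Finset.prod_involution (fun i _ => σ i) ?_ ?_ (fun _ _ => Finset.mem_univ _) ?_
    · intro i _
      rw [hinv]
      have : ε i (σ i) = ε (σ i) i := by
        simp only [ε]
        rw [h1 (σ i) i, h2 (σ i) i]
        simp
      rw [this]
      simp only [ε]
      split_ifs <;> simp
    · intro i _ h hi
      apply h
      simp [ε, hi, hT0 T₁ h1, hT0 T₂ h2]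
    · intro i _; exact hinv i
  calc ∏ i, T₁.charmatrix (σ i) i = ∏ i, (ε (σ i) i * T₂.charmatrix (σ i) i) :=
        Finset.prod_congr rfl fun i _ => hε _ _
    _ = _ := by rw [Finset.prod_mul_distrib, hprod, one_mul]

/-- product of ratios along a walk -/
noncomputable def walkW {V : Type*} (r : V → V → ℝ) {G : SimpleGraph V} :
    ∀ {u v : V}, G.Walk u v → ℝ
  | _, _, .nil => 1
  | _, _, .cons (u := u) (v := w) _ p => r u w * walkW r p

lemma walkW_append {V : Type*} (r : V → V → ℝ) {G : SimpleGraph V} {u v w : V}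
    (p : G.Walk u v) (q : G.Walk v w) : walkW r (p.append q) = walkW r p * walkW r q := by
  induction p with
  | nil => simp [walkW]
  | cons h p ih => simp [walkW, ih, mul_assoc]

lemma walkW_prod {V : Type*} (r : V → V → ℝ) {G : SimpleGraph V} {u v : V}
    (p : G.Walk u v) :
    walkW r p = ∏ i ∈ Finset.range p.length, r (p.getVert i) (p.getVert (i + 1)) := by
  induction p with
  | nil => simp [walkW]
  | cons h p ih =>
    rw [SimpleGraph.Walk.length_cons, Finset.prod_range_succ']
    simp [walkW, ih, mul_comm]

lemma walkW_pos {V : Type*} (r : V → V → ℝ) {G : SimpleGraph V}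
    (hr : ∀ a b, G.Adj a b → 0 < r a b) {u v : V}
    (p : G.Walk u v) : 0 < walkW r p := by
  induction p with
  | nil => simp [walkW]
  | cons h p ih => exact mul_pos (hr _ _ h) ih

lemma walkW_bypass {V : Type*} [DecidableEq V] (r : V → V → ℝ) {G : SimpleGraph V}
    (hr2 : ∀ a b, G.Adj a b → r a b * r b a = 1)
    (hcyc : ∀ k : ℕ, 2 < k → ∀ v : Fin k → V, Function.Injective v →
      (∀ j, G.Adj (v j) (v (finRotate k j))) → ∏ j, r (v j) (v (finRotate k j)) = 1)
    {u v : V} (p : G.Walk u v) : walkW r p.bypass = walkW r p := by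
  have hpath : ∀ {a b : V} (p : G.Walk a b) (_ : p.IsPath) (h : G.Adj b a),
      r b a * walkW r p = 1 := by
    intro a b p hp h
    rw [walkW_prod]
    rcases Nat.lt_or_ge p.length 2 with hl | hl
    · rcases Nat.lt_or_ge p.length 1 with h0 | h1
      · have : p.length = 0 := by omega
        exact absurd (SimpleGraph.Walk.eq_of_length_eq_zero this) h.ne'
      · have h1 : p.length = 1 := by omega
        have hb : p.getVert 1 = b := by rw [← h1]; simp
        rw [h1]
        simp [hb, hr2 b a h]
    · have hcv : ∀ j : Fin (p.length + 1), (j : ℕ) < p.length →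
          (finRotate (p.length + 1) j : ℕ) = j + 1 := by
        intro j hj
        rw [finRotate_val, Nat.mod_eq_of_lt (by omega)]
      have hlast : finRotate (p.length + 1) (Fin.last _) = 0 := by
        apply Fin.ext
        rw [finRotate_val]; simp
      have := hcyc (p.length + 1) (by omega) (fun j => p.getVert j) (by
        intro i j hij
        exact Fin.ext (hp.getVert_injOn (by simp; omega) (by simp; omega) hij)) (by
        intro j
        rcases Nat.lt_or_ge (j : ℕ) p.length with hj | hj
        · simp only [hcv j hj]
          exact p.adj_getVert_succ hj
        · have : j = Fin.last _ := Fin.ext (by simp; omega)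
          rw [this, hlast]
          simpa using h)
      rw [Fin.prod_univ_castSucc, hlast] at this
      simp only [Fin.val_last, Fin.val_zero, SimpleGraph.Walk.getVert_length,
        SimpleGraph.Walk.getVert_zero] at this
      rw [mul_comm, ← this, Finset.prod_range]
      congr 1
      refine Finset.prod_congr rfl fun i _ => ?_
      rw [hcv _ (by simp)]
      simp
  induction p with
  | nil => rfl
  | cons h p ih =>
    rename_i a b c
    rw [SimpleGraph.Walk.bypass]
    have hbp := p.bypass_isPath
    split_ifs with hs
    · rw [walkW, ← ih]
      conv_rhs => rw [← SimpleGraph.Walk.take_spec p.bypass hs, walkW_append]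
      rw [← mul_assoc, hpath _ (hbp.takeUntil hs) h, one_mul]
    · simp [walkW, ih]

lemma exists_potential {V : Type*} [DecidableEq V] (r : V → V → ℝ) {G : SimpleGraph V}
    (hr : ∀ a b, G.Adj a b → 0 < r a b)
    (hr2 : ∀ a b, G.Adj a b → r a b * r b a = 1)
    (hcyc : ∀ k : ℕ, 2 < k → ∀ v : Fin k → V, Function.Injective v →
      (∀ j, G.Adj (v j) (v (finRotate k j))) → ∏ j, r (v j) (v (finRotate k j)) = 1) :
    ∃ m : V → ℝ, (∀ i, 0 < m i) ∧ ∀ i j, G.Adj i j → m j = m i * r i j := by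
  have hclosed : ∀ {u : V} (p : G.Walk u u), walkW r p = 1 := by
    intro u p
    rw [← walkW_bypass r hr2 hcyc p]
    have : p.bypass = .nil := (SimpleGraph.Walk.isPath_iff_nil.1 p.bypass_isPath).eq_nil
    rw [this, walkW]
  have hind : ∀ {u v : V} (p q : G.Walk u v), walkW r p = walkW r q := by
    intro u v p q
    have h1 := hclosed (p.append q.reverse)
    have h2 := hclosed (q.append q.reverse)
    rw [walkW_append] at h1 h2
    have := walkW_pos r hr q.reverse
    exact mul_right_cancel₀ this.ne' (h1.trans h2.symm)
  have hreach : ∀ i, G.Reachable (G.connectedComponentMk i).out i := by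
    intro i
    exact SimpleGraph.ConnectedComponent.exact (Quot.out_eq _)
  refine ⟨fun i => walkW r (hreach i).some, fun i => walkW_pos r hr _, fun i j hij => ?_⟩
  have hc : G.connectedComponentMk i = G.connectedComponentMk j :=
    SimpleGraph.ConnectedComponent.sound hij.reachable
  have hgen : ∀ (a b : V) (p : G.Walk a i) (q : G.Walk b j), a = b →
      walkW r q = walkW r p * r i j := by
    intro a b p q hab
    subst hab
    rw [hind q (p.append (.cons hij .nil)), walkW_append]
    simp [walkW]
  exact hgen _ _ _ _ (by rw [hc])

lemma charpoly_coeff_supp {n k : ℕ} (hk : k ≤ n) (B : Matrix (Fin n) (Fin n) ℝ)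
    (hB : ∀ i, B i i = 0) :
    B.charpoly.coeff (n - k) =
      ∑ σ ∈ Finset.univ.filter (fun σ : Perm (Fin n) => σ.support.card = k),
        ((sign σ : ℤ) : ℝ) * ∏ i ∈ σ.support, (- B (σ i) i) := by
  rw [Matrix.charpoly, Matrix.det_apply', Polynomial.finsetSum_coeff, Finset.sum_filter]
  refine Finset.sum_congr rfl fun σ _ => ?_
  have h1 : ∏ i, B.charmatrix (σ i) i =
      Polynomial.C (∏ i ∈ σ.support, (- B (σ i) i)) * Polynomial.X ^ (n - σ.support.card) := by
    rw [← Finset.prod_mul_prod_compl σ.support]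
    congr 1
    · rw [map_prod]
      refine Finset.prod_congr rfl fun i hi => ?_
      rw [Matrix.charmatrix_apply_ne _ _ _ (mem_support.1 hi)]
      simp
    · have : n - σ.support.card = (σ.supportᶜ).card := by
        rw [Finset.card_compl, Fintype.card_fin]
      rw [this, ← Finset.prod_const]
      refine Finset.prod_congr rfl fun i hi => ?_
      have : σ i = i := by simpa using hi
      rw [this, Matrix.charmatrix_apply_eq, hB]
      simp
  have hle : σ.support.card ≤ n := by
    simpa using Finset.card_le_univ σ.support
  have h2 : (((sign σ : ℤ)) : Polynomial ℝ) = Polynomial.C ((sign σ : ℤ) : ℝ) := by simp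
  rw [h1, h2, ← mul_assoc, ← Polynomial.C_mul, Polynomial.coeff_C_mul_X_pow]
  by_cases h : σ.support.card = k
  · rw [if_pos h, if_pos (by omega)]
  · rw [if_neg h, if_neg (by omega)]

lemma finRotate_induct {k : ℕ} (hk : 0 < k) (P : Fin k → Prop) (h0 : P ⟨0, hk⟩)
    (hs : ∀ j, P j → P (finRotate k j)) : ∀ j, P j := by
  have : ∀ m : ℕ, ∀ h : m < k, P ⟨m, h⟩ := by
    intro m
    induction m with
    | zero => intro h; exact h0
    | succ m ih =>
      intro h
      have h1 := hs _ (ih (by omega))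
      have h2 : finRotate k ⟨m, by omega⟩ = ⟨m + 1, h⟩ := by
        apply Fin.ext
        rw [finRotate_val]
        exact Nat.mod_eq_of_lt h
      rwa [h2] at h1
  intro j
  exact this j j.2

lemma finRotate_two_ne {k : ℕ} (hk : 2 < k) (j : Fin k) :
    finRotate k (finRotate k j) ≠ j := by
  intro h
  have := congrArg Fin.val h
  rw [finRotate_val, finRotate_val] at this
  have hj := j.2
  rcases Nat.lt_or_ge (j + 1 : ℕ) k with h1 | h1
  · rw [Nat.mod_eq_of_lt h1] at this
    rcases Nat.lt_or_ge (j + 1 + 1 : ℕ) k with h2 | h2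
    · rw [Nat.mod_eq_of_lt h2] at this; omega
    · have : (j + 1 + 1 : ℕ) = k := by omega
      simp_all
      omega
  · have h3 : (j + 1 : ℕ) = k := by omega
    rw [h3, Nat.mod_self, Nat.mod_eq_of_lt (by omega)] at this
    omega

lemma cycle_identity {n : ℕ} (A : Matrix (Fin n) (Fin n) ℝ)
    (hdiag : ∀ i, A i i = 0) (hnn : ∀ i j, 0 ≤ A i j)
    (hsymm : ∀ i j, A i j ≠ 0 ↔ A j i ≠ 0)
    (hconst : ∀ B₁ B₂ : Matrix (Fin n) (Fin n) ℝ,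
        IsSkewSigning A B₁ → IsSkewSigning A B₂ → B₁.charpoly = B₂.charpoly)
    (k : ℕ) (hk : 2 < k) (v : Fin k → Fin n) (hv : Function.Injective v) :
    ∏ j, A (v (finRotate k j)) (v j) + (-1) ^ k * ∏ j, A (v j) (v (finRotate k j)) = 0 := by
  classical
  let s : Fin n → Fin n → ℝ := fun i j => if i < j then 1 else -1
  have hs1 : ∀ i j, |s i j| = 1 := by
    intro i j; simp only [s]; split_ifs <;> simp
  have hs0 : ∀ i j, s i j ≠ 0 := by
    intro i j h
    have := hs1 i j
    rw [h] at this; simp at this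
  have hs2 : ∀ i j, i ≠ j → s j i = - s i j := by
    intro i j hij
    simp only [s]
    rcases lt_or_gt_of_ne hij with h | h
    · rw [if_neg h.asymm, if_pos h]
    · rw [if_pos h, if_neg h.asymm]; simp
  let e : Fin k → Fin n → Fin n → ℝ := fun t i j =>
    if (i = v t ∧ j = v (finRotate k t)) ∨ (j = v t ∧ i = v (finRotate k t)) then -1 else 1
  have he1 : ∀ t i j, |e t i j| = 1 := by
    intro t i j; simp only [e]; split_ifs <;> simp
  have hesymm : ∀ t i j, e t i j = e t j i := by
    intro t i j
    simp only [e]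
    exact if_congr or_comm rfl rfl
  let E : Finset (Fin k) → Fin n → Fin n → ℝ := fun T i j => ∏ t ∈ T, e t i j
  have hE1 : ∀ T i j, |E T i j| = 1 := by
    intro T i j
    simp only [E, Finset.abs_prod, he1, Finset.prod_const_one]
  have hEsymm : ∀ T i j, E T i j = E T j i := by
    intro T i j
    exact Finset.prod_congr rfl fun t _ => hesymm t i j
  let B : Finset (Fin k) → Matrix (Fin n) (Fin n) ℝ := fun T => Matrix.of fun i j =>
    s i j * A i j * E T i j
  have hBapp : ∀ T i j, B T i j = s i j * A i j * E T i j := fun T i j => rfl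
  have hBskew : ∀ T, IsSkewSigning A (B T) := by
    intro T
    refine ⟨fun i j => ?_, fun i j hij => ?_⟩
    · rw [hBapp, abs_mul, abs_mul, hs1, hE1, abs_of_nonneg (hnn i j)]; ring
    · have hne : i ≠ j := by rintro rfl; exact hij (hdiag i)
      have hp1 : 0 < A i j := lt_of_le_of_ne (hnn i j) (Ne.symm hij)
      have hp2 : 0 < A j i := lt_of_le_of_ne (hnn j i) (Ne.symm ((hsymm i j).1 hij))
      have hss : s i j * s i j = 1 := by rw [← abs_mul_abs_self, hs1]; ring
      have hee : E T i j * E T i j = 1 := by rw [← abs_mul_abs_self, hE1]; ring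
      rw [hBapp, hBapp, hs2 i j hne, hEsymm T j i]
      have : s i j * A i j * E T i j * (-s i j * A j i * E T i j) =
        - ((s i j * s i j) * (E T i j * E T i j) * (A i j * A j i)) := by ring
      rw [this, hss, hee]
      have := mul_pos hp1 hp2
      linarith
  have hBdiag : ∀ T i, B T i i = 0 := by
    intro T i; rw [hBapp, hdiag]; ring
  have hkn : k ≤ n := by
    simpa using Fintype.card_le_of_injective v hv
  have hk0 : 0 < k := by omega
  let F : Perm (Fin n) → ℝ := fun σ => ((sign σ : ℤ) : ℝ) *
    (∏ i ∈ σ.support, (- (s (σ i) i * A (σ i) i))) *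
      ∏ t, (1 + - ∏ i ∈ σ.support, e t (σ i) i)
  have hsumF : ∑ σ ∈ Finset.univ.filter (fun σ : Perm (Fin n) => σ.support.card = k), F σ = 0 := by
    have h1 : ∑ T ∈ (Finset.univ : Finset (Fin k)).powerset,
        (∏ _t ∈ T, (-1 : ℝ)) * (B T).charpoly.coeff (n - k) = 0 := by
      have : ∀ T, (B T).charpoly = (B ∅).charpoly := fun T => hconst _ _ (hBskew T) (hBskew ∅)
      simp only [this]
      rw [← Finset.sum_mul, ← Finset.prod_one_add]
      have : (∏ _i : Fin k, ((1 : ℝ) + -1)) = 0 :=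
        Finset.prod_eq_zero (Finset.mem_univ ⟨0, hk0⟩) (by norm_num)
      rw [this, zero_mul]
    rw [← h1]
    simp only [charpoly_coeff_supp hkn _ (hBdiag _), Finset.mul_sum]
    rw [Finset.sum_comm]
    refine Finset.sum_congr rfl fun σ _ => ?_
    simp only [F]
    rw [Finset.prod_one_add, Finset.mul_sum]
    refine Finset.sum_congr rfl fun T _ => ?_
    have h2 : ∏ i ∈ σ.support, -B T (σ i) i =
        (∏ i ∈ σ.support, (- (s (σ i) i * A (σ i) i))) *
          ∏ t ∈ T, ∏ i ∈ σ.support, e t (σ i) i := by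
      rw [Finset.prod_comm, ← Finset.prod_mul_distrib]
      refine Finset.prod_congr rfl fun i _ => ?_
      rw [hBapp]
      ring
    have h3 : ∏ t ∈ T, (-∏ i ∈ σ.support, e t (σ i) i) =
        (∏ _t ∈ T, (-1 : ℝ)) * ∏ t ∈ T, ∏ i ∈ σ.support, e t (σ i) i := by
      rw [← Finset.prod_mul_distrib]
      refine Finset.prod_congr rfl fun i _ => ?_
      ring
    rw [h2, h3]
    ring
  -- the cycle
  let c : Perm (Fin n) := (finRotate k).viaFintypeEmbedding ⟨v, hv⟩
  have hcv : ∀ j, c (v j) = v (finRotate k j) := fun j =>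
    viaFintypeEmbedding_apply_image (finRotate k) ⟨v, hv⟩ j
  have hcn : ∀ b, b ∉ Set.range v → c b = b := fun b hb =>
    viaFintypeEmbedding_apply_notMem_range (finRotate k) ⟨v, hv⟩ hb
  have hrot1 : ∀ j, finRotate k j ≠ j := fun j h => finRotate_two_ne hk j (by rw [h, h])
  have hcsupp : c.support = Finset.univ.map ⟨v, hv⟩ := by
    ext b
    simp only [mem_support, Finset.mem_map, Finset.mem_univ, true_and, Function.Embedding.coeFn_mk]
    constructor
    · intro h
      by_contra h'
      exact h (hcn b h')
    · rintro ⟨j, rfl⟩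
      rw [hcv]
      exact fun h => hrot1 j (hv h)
  have hcinv : ∀ j, c⁻¹ (v (finRotate k j)) = v j := by
    intro j; rw [← hcv]; simp
  have hcne : c ≠ c⁻¹ := by
    intro h
    have h1 := hcinv ⟨0, hk0⟩
    rw [← h, hcv] at h1
    exact finRotate_two_ne hk _ (hv h1)
  have hccard : c.support.card = k := by rw [hcsupp]; simp
  have hprodc : ∀ g : Fin n → Fin n → ℝ,
      ∏ i ∈ c.support, g (c i) i = ∏ j, g (v (finRotate k j)) (v j) := by
    intro g
    rw [hcsupp, Finset.prod_map]
    refine Finset.prod_congr rfl fun j _ => ?_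
    simp only [Function.Embedding.coeFn_mk]
    rw [hcv]
  have hprodci : ∀ g : Fin n → Fin n → ℝ,
      ∏ i ∈ (c⁻¹).support, g (c⁻¹ i) i = ∏ j, g (v j) (v (finRotate k j)) := by
    intro g
    rw [support_inv, hcsupp, Finset.prod_map]
    simp only [Function.Embedding.coeFn_mk]
    rw [← Equiv.prod_comp (finRotate k)]
    refine Finset.prod_congr rfl fun j _ => ?_
    rw [hcinv]
  have hF0 : ∀ σ ∈ Finset.univ.filter (fun σ : Perm (Fin n) => σ.support.card = k),
      σ ≠ c ∧ σ ≠ c⁻¹ → F σ = 0 := by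
    intro σ hσ hne
    have hσk : σ.support.card = k := (Finset.mem_filter.1 hσ).2
    by_contra hF
    have huse : ∀ t, σ (v t) = v (finRotate k t) ∨ σ (v (finRotate k t)) = v t := by
      intro t
      by_contra hno
      push Not at hno
      apply hF
      simp only [F]
      rw [Finset.prod_eq_zero (Finset.mem_univ t), mul_zero]
      rw [Finset.prod_eq_one, add_neg_cancel]
      intro i _
      simp only [e]
      rw [if_neg]
      rintro (⟨h1, h2⟩ | ⟨h1, h2⟩)
      · subst h2; exact hno.2 h1
      · subst h1; exact hno.1 h2
    have hmoves : (∀ j, v j ∈ σ.support) → ∀ b, b ∉ Set.range v → σ b = b := by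
      intro h b hb
      have hsub : c.support ⊆ σ.support := by
        rw [hcsupp]
        intro x hx
        obtain ⟨j, _, rfl⟩ := Finset.mem_map.1 hx
        exact h j
      have heq := Finset.eq_of_subset_of_card_le hsub (by rw [hccard, hσk])
      by_contra hb'
      have : b ∈ c.support := by rw [heq]; exact mem_support.2 hb'
      rw [mem_support] at this
      exact this (hcn b hb)
    rcases huse ⟨0, hk0⟩ with h0 | h0
    · have hall := finRotate_induct hk0 (fun j => σ (v j) = v (finRotate k j)) h0 (by
        intro j hj
        rcases huse (finRotate k j) with h | h
        · exact h
        · exfalso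
          rw [← hj] at h
          exact finRotate_two_ne hk j (hv (σ.injective h)))
      have hm := hmoves (fun j => by
        rw [mem_support, hall]
        exact fun h => hrot1 j (hv h))
      apply hne.1
      ext b
      by_cases hb : b ∈ Set.range v
      · obtain ⟨j, rfl⟩ := hb
        rw [hall, hcv]
      · rw [hm b hb, hcn b hb]
    · have hall := finRotate_induct hk0 (fun j => σ (v (finRotate k j)) = v j) h0 (by
        intro j hj
        rcases huse (finRotate k j) with h | h
        · exfalso
          rw [hj] at h
          exact finRotate_two_ne hk j (hv h).symm
        · exact h)
      have hm := hmoves (fun j => by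
        rw [mem_support]
        intro h
        have h2 := hall ((finRotate k).symm j)
        rw [Equiv.apply_symm_apply, h] at h2
        have h3 := hrot1 ((finRotate k).symm j)
        rw [Equiv.apply_symm_apply] at h3
        exact h3 (hv h2))
      apply hne.2
      rw [eq_inv_iff_mul_eq_one]
      ext b
      rw [Perm.mul_apply, Perm.one_apply]
      by_cases hb : b ∈ Set.range v
      · obtain ⟨j, rfl⟩ := hb
        rw [hcv, hall]
      · rw [hcn b hb, hm b hb]
  rw [Finset.sum_eq_add c c⁻¹ hcne hF0 (fun h => absurd (by simp [hccard]) h)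
    (fun h => absurd (by simp [hccard]) h)] at hsumF
  have hfac : ∀ t, ∏ j, e t (v (finRotate k j)) (v j) = -1 := by
    intro t
    rw [Finset.prod_eq_single t]
    · simp [e]
    · intro j _ hj
      simp only [e]
      rw [if_neg]
      rintro (⟨h1, h2⟩ | ⟨h1, h2⟩)
      · have h1 := hv h1
        have h2 := hv h2
        rw [h2] at h1
        exact finRotate_two_ne hk t h1
      · exact hj (hv h1)
    · simp
  have hfac2 : ∀ t, ∏ j, e t (v j) (v (finRotate k j)) = -1 := by
    intro t
    rw [← hfac t]
    exact Finset.prod_congr rfl fun j _ => hesymm _ _ _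
  have h2k : ∏ _t : Fin k, (1 + -(-1 : ℝ)) = 2 ^ k := by
    rw [Finset.prod_const, Finset.card_univ, Fintype.card_fin]
    norm_num
  have hFc : F c = ((sign c : ℤ) : ℝ) * (∏ j, s (v j) (v (finRotate k j))) * 2 ^ k *
      ∏ j, A (v (finRotate k j)) (v j) := by
    simp only [F]
    rw [hprodc (fun a b => -(s a b * A a b))]
    have hq : ∏ t, (1 + - ∏ i ∈ c.support, e t (c i) i) = 2 ^ k := by
      rw [← h2k]
      exact Finset.prod_congr rfl fun t _ => by rw [hprodc (e t), hfac]
    have : ∏ j, -(s (v (finRotate k j)) (v j) * A (v (finRotate k j)) (v j)) =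
      (∏ j, s (v j) (v (finRotate k j))) * ∏ j, A (v (finRotate k j)) (v j) := by
      rw [← Finset.prod_mul_distrib]
      refine Finset.prod_congr rfl fun j _ => ?_
      rw [hs2 (v j) _ (fun h => hrot1 j (hv h).symm)]
      ring
    rw [this, hq]
    ring
  have hFci : F c⁻¹ = ((sign c : ℤ) : ℝ) * (∏ j, s (v j) (v (finRotate k j))) * 2 ^ k *
      ((-1) ^ k * ∏ j, A (v j) (v (finRotate k j))) := by
    simp only [F]
    rw [hprodci (fun a b => -(s a b * A a b))]
    have hq : ∏ t, (1 + - ∏ i ∈ (c⁻¹).support, e t (c⁻¹ i) i) = 2 ^ k := by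
      rw [← h2k]
      exact Finset.prod_congr rfl fun t _ => by rw [hprodci (e t), hfac2]
    have : ∏ j, -(s (v j) (v (finRotate k j)) * A (v j) (v (finRotate k j))) =
      (-1) ^ k * ((∏ j, s (v j) (v (finRotate k j))) * ∏ j, A (v j) (v (finRotate k j))) := by
      have hc : (-1 : ℝ) ^ k = ∏ _j : Fin k, (-1 : ℝ) := by simp
      rw [hc, ← Finset.prod_mul_distrib, ← Finset.prod_mul_distrib]
      refine Finset.prod_congr rfl fun j _ => ?_
      ring
    rw [this, sign_inv, hq]
    ring
  rw [hFc, hFci, ← mul_add] at hsumF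
  refine (mul_eq_zero.1 hsumF).resolve_left ?_
  refine mul_ne_zero (mul_ne_zero ?_ ?_) (by positivity)
  · exact_mod_cast (sign c).ne_zero
  · exact Finset.prod_ne_zero_iff.2 fun j _ => hs0 _ _

lemma charpoly_diag_conj {n : ℕ} (d : Fin n → ℝ) (hd : ∀ i, 0 < d i)
    (B : Matrix (Fin n) (Fin n) ℝ) :
    (Matrix.of fun i j => d i * B i j * (d j)⁻¹ : Matrix (Fin n) (Fin n) ℝ).charpoly =
      B.charpoly := by
  have h1 : Matrix.diagonal d * Matrix.diagonal (fun i => (d i)⁻¹) = 1 := by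
    rw [Matrix.diagonal_mul_diagonal, ← Matrix.diagonal_one]
    congr 1; ext i; exact mul_inv_cancel₀ (hd i).ne'
  have h2 : Matrix.diagonal (fun i => (d i)⁻¹) * Matrix.diagonal d = 1 := by
    rw [Matrix.diagonal_mul_diagonal, ← Matrix.diagonal_one]
    congr 1; ext i; exact inv_mul_cancel₀ (hd i).ne'
  let U : (Matrix (Fin n) (Fin n) ℝ)ˣ := ⟨Matrix.diagonal d, Matrix.diagonal (fun i => (d i)⁻¹), h1, h2⟩
  have := Matrix.charpoly_units_conj U B
  rw [← this]
  congr 1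
  have hU : (U : Matrix (Fin n) (Fin n) ℝ)⁻¹ = Matrix.diagonal (fun i => (d i)⁻¹) :=
    Matrix.inv_eq_left_inv h2
  rw [hU]
  ext i j
  simp [U, Matrix.mul_diagonal, Matrix.diagonal_mul]

lemma diag_inv {n : ℕ} (d : Fin n → ℝ) (hd : ∀ i, 0 < d i) :
    (Matrix.diagonal d)⁻¹ = Matrix.diagonal (fun i => (d i)⁻¹) := by
  apply Matrix.inv_eq_left_inv
  rw [Matrix.diagonal_mul_diagonal, ← Matrix.diagonal_one]
  congr 1; ext i; exact inv_mul_cancel₀ (hd i).ne'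

end Helpers

/- Statement 17 (Main Theorem): for a positive weighted loopless symmetric digraph with
weighted adjacency matrix A, all skew-signings yield the same characteristic polynomial if
and only if the digraph has no directed cycle of even length greater than 2 and
A = Δ⁻¹ S Δ for some nonnegative symmetric S with zero diagonal and diagonal Δ with
positive diagonal entries. -/
theorem stmt_17 (n : ℕ) (A : Matrix (Fin n) (Fin n) ℝ)
    (hdiag : ∀ i, A i i = 0) (hnn : ∀ i j, 0 ≤ A i j)
    (hsymm : ∀ i j, A i j ≠ 0 ↔ A j i ≠ 0) :
    (∀ B₁ B₂ : Matrix (Fin n) (Fin n) ℝ,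
        IsSkewSigning A B₁ → IsSkewSigning A B₂ → B₁.charpoly = B₂.charpoly) ↔
      ((∀ k : ℕ, 2 < k → Even k → ∀ v : Fin k → Fin n, Function.Injective v →
          ∃ j : Fin k, A (v j) (v (finRotate k j)) = 0) ∧
        ∃ S Δ : Matrix (Fin n) (Fin n) ℝ, Sᵀ = S ∧ (∀ i j, 0 ≤ S i j) ∧
          (∀ i, S i i = 0) ∧ Δ.IsDiag ∧ (∀ i, 0 < Δ i i) ∧ A = Δ⁻¹ * S * Δ) := by
  constructor
  · intro hconst
    have hpos : ∀ i j, A i j ≠ 0 → 0 < A i j := fun i j h => lt_of_le_of_ne (hnn i j) (Ne.symm h)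
    have hid := cycle_identity A hdiag hnn hsymm hconst
    have heven : ∀ k : ℕ, 2 < k → Even k → ∀ v : Fin k → Fin n, Function.Injective v →
          ∃ j : Fin k, A (v j) (v (finRotate k j)) = 0 := by
      intro k hk he v hv
      by_contra hno
      push Not at hno
      have h1 := hid k hk v hv
      rw [he.neg_one_pow, one_mul] at h1
      have h2 : 0 < ∏ j, A (v j) (v (finRotate k j)) :=
        Finset.prod_pos fun j _ => hpos _ _ (hno j)
      have h3 : 0 ≤ ∏ j, A (v (finRotate k j)) (v j) :=
        Finset.prod_nonneg fun j _ => hnn _ _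
      linarith
    refine ⟨heven, ?_⟩
    let G : SimpleGraph (Fin n) :=
      { Adj := fun i j => A i j ≠ 0
        symm := ⟨fun i j h => (hsymm i j).1 h⟩
        loopless := ⟨fun i h => h (hdiag i)⟩ }
    obtain ⟨m, hm, hmr⟩ := exists_potential (G := G) (fun i j => A i j / A j i)
      (fun a b h => div_pos (hpos _ _ h) (hpos _ _ ((hsymm a b).1 h)))
      (fun a b h => by
        have h1 : A a b ≠ 0 := h
        have h2 : A b a ≠ 0 := (hsymm a b).1 h
        field_simp)
      (fun k hk v hv hadj => by
        rcases Nat.even_or_odd k with he | ho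
        · obtain ⟨j, hj⟩ := heven k hk he v hv
          exact absurd hj (hadj j)
        · have h1 := hid k hk v hv
          rw [ho.neg_one_pow] at h1
          rw [Finset.prod_div_distrib]
          have h2 : 0 < ∏ j, A (v j) (v (finRotate k j)) :=
            Finset.prod_pos fun j _ => hpos _ _ (hadj j)
          have h3 : ∏ j, A (v (finRotate k j)) (v j) = ∏ j, A (v j) (v (finRotate k j)) := by
            linarith
          rw [h3, div_self h2.ne'])
    have hmA : ∀ i j, m i * A i j = m j * A j i := by
      intro i j
      by_cases h : A i j = 0
      · have h' : A j i = 0 := by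
          by_contra h'
          exact (hsymm j i).1 h' h
        rw [h, h']; ring
      · have h' : A j i ≠ 0 := (hsymm i j).1 h
        rw [hmr i j h]
        field_simp
    let d : Fin n → ℝ := fun i => Real.sqrt (m i)
    have hd : ∀ i, 0 < d i := fun i => Real.sqrt_pos.2 (hm i)
    have hdd : ∀ i, d i * d i = m i := fun i => Real.mul_self_sqrt (hm i).le
    refine ⟨Matrix.of fun i j => d i * A i j * (d j)⁻¹, Matrix.diagonal d, ?_, ?_, ?_, ?_, ?_, ?_⟩
    · ext i j
      simp only [Matrix.transpose_apply, Matrix.of_apply]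
      have h1 := (hd i).ne'
      have h2 := (hd j).ne'
      field_simp
      have := hmA i j
      rw [← hdd, ← hdd] at this
      linarith
    · intro i j
      exact mul_nonneg (mul_nonneg (hd i).le (hnn i j)) (inv_nonneg.2 (hd j).le)
    · intro i
      simp [hdiag]
    · exact Matrix.isDiag_diagonal d
    · intro i
      simpa using hd i
    · rw [diag_inv d hd]
      ext i j
      have h1 := (hd i).ne'
      have h2 := (hd j).ne'
      simp only [Matrix.mul_diagonal, Matrix.diagonal_mul, Matrix.of_apply]
      field_simp
  · rintro ⟨hev, S, Δ, hS, hSnn, hS0, hΔ, hΔpos, hA⟩ B₁ B₂ hB₁ hB₂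
    let d : Fin n → ℝ := fun i => Δ i i
    have hd : ∀ i, 0 < d i := hΔpos
    have hΔd : Δ = Matrix.diagonal d := hΔ.diagonal_diag.symm
    rw [hΔd, diag_inv d hd] at hA
    have hAS : ∀ i j, S i j = d i * A i j * (d j)⁻¹ := by
      intro i j
      have h1 := (hd i).ne'
      have h2 := (hd j).ne'
      rw [hA]
      simp only [Matrix.mul_diagonal, Matrix.diagonal_mul]
      field_simp
    have hSsymm : ∀ i j, S i j = S j i := fun i j => congrFun (congrFun hS j) i
    rw [← charpoly_diag_conj d hd B₁, ← charpoly_diag_conj d hd B₂]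
    have habs : ∀ B, IsSkewSigning A B → ∀ i j, |d i * B i j * (d j)⁻¹| = S i j := by
      intro B hB i j
      rw [abs_mul, abs_mul, hB.1, abs_of_pos (hd i), abs_of_pos (inv_pos.2 (hd j)), hAS]
    have hskew : ∀ B, IsSkewSigning A B →
        ∀ i j, d j * B j i * (d i)⁻¹ = - (d i * B i j * (d j)⁻¹) := by
      intro B hB i j
      have h1 := habs B hB i j
      have h2 := habs B hB j i
      rw [hSsymm j i, ← h1] at h2
      rcases abs_eq_abs.1 h2 with h | h
      · by_cases hz : A i j = 0
        · have hb : B i j = 0 := by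
            have := hB.1 i j
            rw [hz] at this
            exact abs_eq_zero.1 this
          rw [h, hb]; simp
        · exfalso
          have hneg := hB.2 i j hz
          have h3 : (d i * B i j * (d j)⁻¹) * (d j * B j i * (d i)⁻¹) = B i j * B j i := by
            have h1 := (hd i).ne'
            have h2 := (hd j).ne'
            field_simp
          rw [h] at h3
          have := mul_self_nonneg (d i * B i j * (d j)⁻¹)
          linarith
      · exact h
    refine charpoly_eq_of_skew _ _ (hskew B₁ hB₁) (hskew B₂ hB₂) ?_ ?_
    · intro i j
      simp only [Matrix.of_apply]
      rw [habs B₁ hB₁, habs B₂ hB₂]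
    · intro k hk he v hv
      obtain ⟨j, hj⟩ := hev k hk he v hv
      refine ⟨j, ?_⟩
      have hb := hB₁.1 (v j) (v (finRotate k j))
      rw [hj] at hb
      simp only [Matrix.of_apply]
      rw [abs_eq_zero.1 hb]
      ring
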